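/- Let b, c, k₁, σ > 0 with b·σ·√(2π) > k₁, let θ̂(μ) denote the unique solution of b·θ + c + k₁ = k₁·Φ((θ − μ)/σ), let κ > 0, and define P(μ) := Φ(κ·(θ̂(μ) − μ)). Then for every y ∈ (0, 1) there exists a unique μ* ∈ ℝ such that P(μ*) = 1 − y, and for all μ ∈ ℝ one has P(μ) > 1 − y if and only if μ < μ*. -/

import Mathlib

open Real MeasureTheory

/-- The standard normal cumulative distribution function
`Φ(z) = (1/√(2π)) ∫_{−∞}^{z} exp(−t²/2) dt`. -/
noncomputable def stdNormalCDF (z : ℝ) : ℝ :=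
  (Real.sqrt (2 * Real.pi))⁻¹ * ∫ t in Set.Iic z, Real.exp (-t ^ 2 / 2)

lemma integrable_exp_neg_sq_div_two : Integrable fun t : ℝ => Real.exp (-t ^ 2 / 2) := by
  convert integrable_exp_neg_mul_sq (b := 1 / 2) (by norm_num) using 3
  ring

lemma stdNormalCDF_eq_cdf (z : ℝ) :
    stdNormalCDF z = ProbabilityTheory.cdf (ProbabilityTheory.gaussianReal 0 1) z := by
  rw [ProbabilityTheory.cdf_eq_real, Measure.real,
    ProbabilityTheory.gaussianReal_apply_eq_integral 0 one_ne_zero,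
    ENNReal.toReal_ofReal (setIntegral_nonneg measurableSet_Iic fun t _ =>
      ProbabilityTheory.gaussianPDFReal_nonneg 0 1 t),
    stdNormalCDF, ← integral_const_mul]
  simp [ProbabilityTheory.gaussianPDFReal]

lemma stdNormalCDF_sub (x y : ℝ) :
    stdNormalCDF y - stdNormalCDF x =
      (Real.sqrt (2 * Real.pi))⁻¹ * ∫ t in x..y, Real.exp (-t ^ 2 / 2) := by
  rw [← intervalIntegral.integral_Iic_sub_Iic integrable_exp_neg_sq_div_two.integrableOn
    integrable_exp_neg_sq_div_two.integrableOn, stdNormalCDF, stdNormalCDF, mul_sub]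

lemma stdNormalCDF_strictMono : StrictMono stdNormalCDF := by
  intro x y hxy
  rw [← sub_pos, stdNormalCDF_sub]
  have := intervalIntegral.intervalIntegral_pos_of_pos
    (integrable_exp_neg_sq_div_two.intervalIntegrable (a := x) (b := y))
    (fun t => Real.exp_pos _) hxy
  positivity

lemma stdNormalCDF_sub_le {x y : ℝ} (hxy : x ≤ y) :
    stdNormalCDF y - stdNormalCDF x ≤ (Real.sqrt (2 * Real.pi))⁻¹ * (y - x) := by
  rw [stdNormalCDF_sub]
  gcongr
  have h := intervalIntegral.integral_mono_on hxy
    integrable_exp_neg_sq_div_two.intervalIntegrable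
    (intervalIntegrable_const (c := (1 : ℝ)) (μ := volume))
    (fun t _ => Real.exp_le_one_iff.2 (by nlinarith [sq_nonneg t]))
  simpa using h

lemma continuous_stdNormalCDF : Continuous stdNormalCDF := by
  refine (LipschitzWith.of_le_add_mul ⟨(Real.sqrt (2 * Real.pi))⁻¹, by positivity⟩
    fun x y => ?_).continuous
  change _ ≤ stdNormalCDF y + (Real.sqrt (2 * Real.pi))⁻¹ * dist x y
  rcases le_total y x with h | h
  · rw [Real.dist_eq, abs_of_nonneg (sub_nonneg.2 h)]
    linarith [stdNormalCDF_sub_le h]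
  · have : 0 ≤ (Real.sqrt (2 * Real.pi))⁻¹ * dist x y := by positivity
    linarith [stdNormalCDF_strictMono.monotone h]

lemma exists_stdNormalCDF_eq {p : ℝ} (h0 : 0 < p) (h1 : p < 1) : ∃ z, stdNormalCDF z = p := by
  have hcdf : stdNormalCDF = ProbabilityTheory.cdf (ProbabilityTheory.gaussianReal 0 1) :=
    funext stdNormalCDF_eq_cdf
  refine mem_range_of_exists_le_of_exists_ge continuous_stdNormalCDF ?_ ?_
  · rw [hcdf]
    exact ((ProbabilityTheory.tendsto_cdf_atBot _).eventually_le_const h0).exists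
  · rw [hcdf]
    exact ((ProbabilityTheory.tendsto_cdf_atTop _).eventually_const_le h1).exists

/-- If the slope of `k * Φ(· / σ)` is everywhere below `b`, then `k * Φ(u / σ) - b * u` is
strictly decreasing in `u`. -/
lemma strictAnti_mul_stdNormalCDF_sub {b k σ : ℝ} (hk : 0 < k) (hσ : 0 < σ)
    (hslope : k < b * σ * Real.sqrt (2 * Real.pi)) :
    StrictAnti fun u => k * stdNormalCDF (u / σ) - b * u := by
  intro u v huv
  have h := mul_le_mul_of_nonneg_left
    (stdNormalCDF_sub_le (div_le_div_of_nonneg_right huv.le hσ.le)) hk.le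
  have h2 : k * ((Real.sqrt (2 * Real.pi))⁻¹ * (v / σ - u / σ)) < b * (v - u) := by
    have e : k * ((Real.sqrt (2 * Real.pi))⁻¹ * (v / σ - u / σ)) =
        k / (σ * Real.sqrt (2 * Real.pi)) * (v - u) := by
      field_simp
    rw [e]
    refine mul_lt_mul_of_pos_right ?_ (sub_pos.2 huv)
    rw [div_lt_iff₀ (by positivity)]
    linarith
  dsimp only
  linarith

/-- Proposition 2: in the unique-equilibrium case (`b·σ·√(2π) > k₁`), with
`θ̂(μ)` the unique solution of `b·θ + c + k₁ = k₁·Φ((θ − μ)/σ)`, `κ > 0`, and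
expected protest `P(μ) = Φ(κ·(θ̂(μ) − μ))`, for every yield payoff `y ∈ (0, 1)`
there is a unique `μ*` with `P(μ*) = 1 − y`, and the incumbent steps down
(`P(μ) > 1 − y`) if and only if `μ < μ*`. -/
theorem stmt12 (b c k₁ σ : ℝ) (hb : 0 < b) (hc : 0 < c) (hk : 0 < k₁) (hσ : 0 < σ)
    (hslope : b * σ * Real.sqrt (2 * Real.pi) > k₁)
    (f : ℝ → ℝ)
    (hf : ∀ μ : ℝ, b * f μ + c + k₁ = k₁ * stdNormalCDF ((f μ - μ) / σ))
    (κ : ℝ) (hκ : 0 < κ)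
    (y : ℝ) (hy0 : 0 < y) (hy1 : y < 1) :
    ∃ μs : ℝ, stdNormalCDF (κ * (f μs - μs)) = 1 - y ∧
      (∀ μ' : ℝ, stdNormalCDF (κ * (f μ' - μ')) = 1 - y → μ' = μs) ∧
      ∀ μ : ℝ, stdNormalCDF (κ * (f μ - μ)) > 1 - y ↔ μ < μs := by
  obtain ⟨z, hz⟩ := exists_stdNormalCDF_eq (sub_pos.2 hy1) (sub_lt_self 1 hy0)
  have hg := strictAnti_mul_stdNormalCDF_sub hk hσ hslope
  have hfg (μ : ℝ) : k₁ * stdNormalCDF ((f μ - μ) / σ) - b * (f μ - μ) = b * μ + c + k₁ := by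
    linarith [hf μ]
  obtain ⟨μs, hμs⟩ : ∃ μs, f μs - μs = z / κ := by
    refine ⟨(k₁ * stdNormalCDF (z / κ / σ) - b * (z / κ) - c - k₁) / b, hg.injective ?_⟩
    rw [hfg, mul_div_cancel₀ _ hb.ne']
    ring
  have hP : stdNormalCDF (κ * (f μs - μs)) = 1 - y := by
    rw [hμs, mul_div_cancel₀ _ hκ.ne', hz]
  have hanti : StrictAnti fun μ => f μ - μ := by
    intro μ ν hμν
    refine hg.lt_iff_gt.1 ?_
    dsimp only
    rw [hfg, hfg]
    gcongr
  have hPanti : StrictAnti fun μ => stdNormalCDF (κ * (f μ - μ)) := fun μ ν hμν =>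
    stdNormalCDF_strictMono (mul_lt_mul_of_pos_left (hanti hμν) hκ)
  refine ⟨μs, hP, fun μ' h => hPanti.injective (h.trans hP.symm), fun μ => ?_⟩
  rw [← hP]
  exact hPanti.lt_iff_gt
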